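/- Fix θ > 0, an integer N ≥ 3, a ∈ 𝒫_N, and an integer n with 1 ≤ n ≤ N−2. Let g denote the Lebesgue density of the pushforward of the orbital beta process 𝕄^{a,θ} under the projection to the (n+1)-st level x^{(n+1)}. Then the pushforward of 𝕄^{a,θ} under the projection to the levels (x^{(1)}, …, x^{(n)}, x^{(n+1)}) has Lebesgue density equal (almost everywhere on the set x^{(1)} ≺ ⋯ ≺ x^{(n)} ≺ x^{(n+1)}) to g(x^{(n+1)}) · ( ∏_{k=1}^{n+1} Γ(kθ) / Γ(θ)^{(n+1)(n+2)/2} ) · ∏_{1≤i<j≤n+1} (x_i^{(n+1)} − x_j^{(n+1)})^{1−2θ} · ∏_{k=1}^{n} [ ∏_{1≤i<j≤k} (x_i^{(k)} − x_j^{(k)})^{2−2θ} ∏_{a'=1}^{k} ∏_{b=1}^{k+1} |x_{a'}^{(k)} − x_b^{(k+1)}|^{θ−1} ]; that is, conditioned on level n+1, the lower levels are distributed by the θ-Gibbs conditional density. -/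

import Mathlib

open MeasureTheory Filter Topology
open scoped ENNReal

noncomputable section

/-- A triangular array with `M` levels: for `k : Fin M`, level `k+1` has `k+1` real entries. -/
abbrev Tri (M : ℕ) := ∀ k : Fin M, Fin (k.1 + 1) → ℝ

/-- `Interlaces u v` means `u ≺ v`, i.e. `v 1 > u 1 > v 2 > u 2 > ⋯ > v n > u n > v (n+1)`. -/
def Interlaces {n : ℕ} (u : Fin n → ℝ) (v : Fin (n + 1) → ℝ) : Prop :=
  ∀ i : Fin n, u i < v i.castSucc ∧ v i.succ < u i

/-- Level `k+1` (for `k < N`) of the configuration consisting of the triangular array `x`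
(levels `1, …, N-1`) together with the top level `a` (level `N`). -/
def lvl {N : ℕ} (a : Fin N → ℝ) (x : Tri (N - 1)) (k : ℕ) (hk : k < N) :
    Fin (k + 1) → ℝ :=
  if h : k < N - 1 then fun i => x ⟨k, h⟩ i
  else fun i => a ⟨i.1, by have := i.isLt; omega⟩

/-- The (unnormalized) density of the orbital beta process with top level `a`. -/
def obpWt (θ : ℝ) {N : ℕ} (a : Fin N → ℝ) (x : Tri (N - 1)) : ℝ :=
  ∏ k : Fin (N - 1),
    ((∏ i : Fin (k.1 + 1), ∏ j : Fin (k.1 + 1),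
        if i < j then |x k i - x k j| ^ (2 - 2 * θ) else 1) *
      ∏ s : Fin (k.1 + 2), ∏ r : Fin (k.1 + 1),
        |lvl a x (k.1 + 1) (by have := k.isLt; omega) s - x k r| ^ (θ - 1))

/-- The interlacing scheme `𝒫(a)`: arrays `(a⁽¹⁾ ≺ a⁽²⁾ ≺ ⋯ ≺ a⁽ᴺ⁻¹⁾ ≺ a)`. -/
def obpDomain {N : ℕ} (a : Fin N → ℝ) : Set (Tri (N - 1)) :=
  {x | ∀ k : Fin (N - 1),
      Interlaces (x k) (lvl a x (k.1 + 1) (by have := k.isLt; omega))}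

/-- The orbital beta process `𝕄^{a,θ}` with top level `a`. -/
def obp (θ : ℝ) {N : ℕ} (a : Fin N → ℝ) : Measure (Tri (N - 1)) :=
  (ENNReal.ofReal (∫ x in obpDomain a, obpWt θ a x))⁻¹ •
    volume.withDensity fun x =>
      ENNReal.ofReal ((obpDomain a).indicator (obpWt θ a) x)

/-- The Weyl chamber `𝒲_m = {x : x 0 ≥ x 1 ≥ ⋯}`. -/
def weylChamber (m : ℕ) : Set (Fin m → ℝ) :=
  {x | ∀ i j : Fin m, i ≤ j → x j ≤ x i}

/-- The (unnormalized) density of the Gaussian beta ensemble. -/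
def gbeWt (θ : ℝ) (m : ℕ) (x : Fin m → ℝ) : ℝ :=
  (∏ i : Fin m, ∏ j : Fin m, if i < j then |x i - x j| ^ (2 * θ) else 1) *
    Real.exp (-(θ / 2) * ∑ i, x i ^ 2)

/-- The Gaussian beta ensemble `𝕄^{(θ)}_m` of rank `m`. -/
def gbe (θ : ℝ) (m : ℕ) : Measure (Fin m → ℝ) :=
  (ENNReal.ofReal (∫ x in weylChamber m, gbeWt θ m x))⁻¹ •
    volume.withDensity fun x =>
      ENNReal.ofReal ((weylChamber m).indicator (gbeWt θ m) x)

/-- The empirical measure `μ_N = (1/N) ∑ δ_{a_i/N}`. -/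
def empMeasure {N : ℕ} (a : Fin N → ℝ) : Measure ℝ :=
  ((N : ℝ≥0∞))⁻¹ • ∑ i : Fin N, Measure.dirac (a i / N)

/-- The mean `𝔼[ν]` of a measure on `ℝ`. -/
def meanM (ν : Measure ℝ) : ℝ := ∫ t, t ∂ν

/-- The variance `Var[ν]` of a measure on `ℝ`. -/
def varM (ν : Measure ℝ) : ℝ := (∫ t, t ^ 2 ∂ν) - meanM ν ^ 2

/-- A regular sequence of ordered tuples with limiting measure `μ`. -/
def RegularSeq (a : (N : ℕ) → Fin N → ℝ) (μ : Measure ℝ) : Prop :=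
  (∀ N : ℕ, 1 ≤ N → StrictAnti (a N)) ∧
  (∃ C : ℝ, ∀ N : ℕ, ∀ hN : 1 ≤ N,
      |a N ⟨0, by omega⟩| ≤ C * N ∧ |a N ⟨N - 1, by omega⟩| ≤ C * N) ∧
  IsProbabilityMeasure μ ∧
  (∃ R : ℝ, μ {t : ℝ | |t| ≤ R}ᶜ = 0) ∧
  ∀ f : BoundedContinuousFunction ℝ ℝ,
    Tendsto (fun N : ℕ => ∫ t, f t ∂empMeasure (a N)) atTop (𝓝 (∫ t, f t ∂μ))

/-- Projection of a triangular array (with top level of size `N`) to its `m`-th level. -/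
def levelProj {N : ℕ} (m : ℕ) (h1 : 1 ≤ m) (h2 : m < N) (x : Tri (N - 1)) :
    Fin m → ℝ :=
  fun i => x ⟨m - 1, by omega⟩ ⟨i.1, (by have := i.isLt; omega : i.1 < m - 1 + 1)⟩

/-- Projection of a triangular array to its bottom `m` levels. -/
def triProj {N : ℕ} (m : ℕ) (h : m < N) (x : Tri (N - 1)) : Tri m :=
  fun k i => x ⟨k.1, by have := k.isLt; omega⟩ ⟨i.1, i.isLt⟩

/-- The top level of a triangular array with `m` levels. -/
def topLvl {m : ℕ} (hm : 1 ≤ m) (x : Tri m) : Fin m → ℝ :=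
  fun i => x ⟨m - 1, by omega⟩ ⟨i.1, (by have := i.isLt; omega : i.1 < m - 1 + 1)⟩

/-- The Gelfand–Tsetlin polytope `𝒲_{m,corners}` (weak interlacing). -/
def gtPoly (m : ℕ) : Set (Tri m) :=
  {x | ∀ k : Fin m, ∀ hk : k.1 + 1 < m, ∀ i : Fin (k.1 + 1),
      x k i ≤ x ⟨k.1 + 1, hk⟩ i.castSucc ∧ x ⟨k.1 + 1, hk⟩ i.succ ≤ x k i}

/-- Unnormalized density of the Gaussian beta corners process with `m` levels. -/
def gbcWt (θ : ℝ) {m : ℕ} (hm : 1 ≤ m) (x : Tri m) : ℝ :=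
  (∏ i : Fin m, ∏ j : Fin m,
      if i < j then topLvl hm x i - topLvl hm x j else 1) *
    Real.exp (-(θ / 2) * ∑ i, topLvl hm x i ^ 2) *
    ∏ k : Fin (m - 1),
      ((∏ i : Fin (k.1 + 1), ∏ j : Fin (k.1 + 1),
          if i < j then
            |x ⟨k.1, by have := k.isLt; omega⟩ i -
              x ⟨k.1, by have := k.isLt; omega⟩ j| ^ (2 - 2 * θ)
          else 1) *
        ∏ i : Fin (k.1 + 1), ∏ j : Fin (k.1 + 2),
          |x ⟨k.1, by have := k.isLt; omega⟩ i -
            x ⟨k.1 + 1, by have := k.isLt; omega⟩ j| ^ (θ - 1))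

/-- The Gaussian beta corners process `𝕄^{(θ)}_{m,corners}`. -/
def gbc (θ : ℝ) {m : ℕ} (hm : 1 ≤ m) : Measure (Tri m) :=
  (ENNReal.ofReal (∫ x in gtPoly m, gbcWt θ hm x))⁻¹ •
    volume.withDensity fun x =>
      ENNReal.ofReal ((gtPoly m).indicator (gbcWt θ hm) x)

/-- Strict interlacing domain `x⁽¹⁾ ≺ x⁽²⁾ ≺ ⋯ ≺ x⁽ᵐ⁾` inside `Tri m`. -/
def triDomain (m : ℕ) : Set (Tri m) :=
  {x | ∀ k : Fin m, ∀ hk : k.1 + 1 < m, Interlaces (x k) (x ⟨k.1 + 1, hk⟩)}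

/-- The θ-Gibbs conditional density of the bottom `n` levels given level `n+1`. -/
def gibbsWt (θ : ℝ) (n : ℕ) (x : Tri (n + 1)) : ℝ :=
  ((∏ k : Fin (n + 1), Real.Gamma ((k.1 + 1) * θ)) /
      Real.Gamma θ ^ ((n + 1) * (n + 2) / 2)) *
    (∏ i : Fin (n + 1), ∏ j : Fin (n + 1),
      if i < j then
        (x ⟨n, Nat.lt_succ_self n⟩ i - x ⟨n, Nat.lt_succ_self n⟩ j) ^ (1 - 2 * θ)
      else 1) *
    ∏ k : Fin n,
      ((∏ i : Fin (k.1 + 1), ∏ j : Fin (k.1 + 1),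
          if i < j then
            (x ⟨k.1, by have := k.isLt; omega⟩ i -
              x ⟨k.1, by have := k.isLt; omega⟩ j) ^ (2 - 2 * θ)
          else 1) *
        ∏ i : Fin (k.1 + 1), ∏ j : Fin (k.1 + 2),
          |x ⟨k.1, by have := k.isLt; omega⟩ i -
            x ⟨k.1 + 1, by have := k.isLt; omega⟩ j| ^ (θ - 1))

/-- `|a⁽ᵏ⁾|`, the sum of the entries of level `k` (with `a⁽⁰⁾ := 0` and `a⁽ᴺ⁾ := a`). -/
def sumLvl {N : ℕ} (a : Fin N → ℝ) (x : Tri (N - 1)) (k : ℕ) : ℝ :=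
  if k = 0 then 0
  else if h : k - 1 < N - 1 then ∑ i, x ⟨k - 1, h⟩ i
  else ∑ i, a i

/-- The multivariate Bessel function `𝓑_a(y; θ)`, defined through its combinatorial
integral representation over the interlacing scheme with top level `a`. -/
def MBF (θ : ℝ) {N : ℕ} (a : Fin N → ℝ) (y : Fin N → ℂ) : ℂ :=
  ((((∏ k : Fin N, Real.Gamma ((k.1 + 1) * θ)) /
        Real.Gamma θ ^ (N * (N + 1) / 2)) : ℝ) : ℂ) *
    (((∏ i : Fin N, ∏ j : Fin N,
        if i < j then |a i - a j| ^ (1 - 2 * θ) else 1) : ℝ) : ℂ) *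
    ∫ x in obpDomain a,
      Complex.exp (∑ k : Fin N,
        y k * ((sumLvl a x (k.1 + 1) - sumLvl a x k.1 : ℝ) : ℂ)) *
      ((obpWt θ a x : ℝ) : ℂ)

/-- Padding of an `m`-tuple with `N - m` zeros: `(y_1, …, y_m, 0^{N-m})`. -/
def padC {m N : ℕ} (_h : m ≤ N) (y : Fin m → ℂ) : Fin N → ℂ :=
  fun k => if h' : k.1 < m then y ⟨k.1, h'⟩ else 0

/-- Integrand `exp(yz) ∏ (z - a_i)^{-θ}` of the left-directed contour integral,
with `w^{-θ} := exp(-θ Log w)` for the principal branch `Log`. -/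
def contourFnL (θ : ℝ) {N : ℕ} (a : Fin N → ℝ) (y z : ℂ) : ℂ :=
  Complex.exp (y * z) *
    ∏ i : Fin N, Complex.exp (-(θ : ℂ) * Complex.log (z - (a i : ℂ)))

/-- Integrand `exp(-yz) ∏ (a_i - z)^{-θ}` of the right-directed contour integral. -/
def contourFnR (θ : ℝ) {N : ℕ} (a : Fin N → ℝ) (y z : ℂ) : ℂ :=
  Complex.exp (-y * z) *
    ∏ i : Fin N, Complex.exp (-(θ : ℂ) * Complex.log ((a i : ℂ) - z))

/-- `(y_1, …, y_m, y_{m+1})` with `y_{m+1} := y - (z_1 + ⋯ + z_m)`. -/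
def Yext {m : ℕ} (ys : Fin m → ℝ) (y : ℝ) (z : Fin m → ℝ) : Fin (m + 1) → ℝ :=
  fun j => if h : j.1 < m then ys ⟨j.1, h⟩ else y - ∑ i, z i

/-- `(z_1, …, z_m, z_{m+1})` with `z_{m+1} := 0`. -/
def Zext {m : ℕ} (z : Fin m → ℝ) : Fin (m + 1) → ℝ :=
  fun j => if h : j.1 < m then z ⟨j.1, h⟩ else 0

/-- The function `G_{θ, y_1, …, y_m, y}(z_1, …, z_m)`. -/
def Gfn (θ : ℝ) {m : ℕ} (ys : Fin m → ℝ) (y : ℝ) (z : Fin m → ℝ) : ℝ :=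
  (∏ i : Fin m, ∏ j : Fin m,
      if i < j then (ys i - ys j + z i) ^ (θ - 1) else 1) *
    ∏ i : Fin (m + 1), ∏ j : Fin (m + 1),
      if i < j then
        (Yext ys y z i - Yext ys y z j + Zext z i - Zext z j) *
          (Yext ys y z i - Yext ys y z j - Zext z j) ^ (θ - 1)
      else 1

/-- The function `F_{y_1, …, y_m, y}(z_1, …, z_m)`. -/
def Ffn {m : ℕ} (ys : Fin m → ℝ) (y : ℝ) (z : Fin m → ℝ) : ℝ :=
  (1 - (∑ i, z i) / y) * ∏ i, (1 + z i / ys i)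

/-- The absolute value of the Vandermonde product of `u`. -/
def vdm {k : ℕ} (u : Fin k → ℝ) : ℝ :=
  ∏ i : Fin k, ∏ j : Fin k, if i < j then |u i - u j| else 1

lemma vdm_nonneg {k : ℕ} (u : Fin k → ℝ) : 0 ≤ vdm u :=
  Finset.prod_nonneg fun i _ => Finset.prod_nonneg fun j _ => by split_ifs <;> positivity

lemma vdm_pos {k : ℕ} {u : Fin k → ℝ} (hu : StrictAnti u) : 0 < vdm u :=
  Finset.prod_pos fun i _ => Finset.prod_pos fun j _ => by
    split_ifs with h
    · exact abs_pos.2 (sub_ne_zero.2 (hu h).ne')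
    · exact one_pos

lemma prod_abs_sub_rpow {k : ℕ} (u : Fin k → ℝ) (p : ℝ) :
    (∏ i : Fin k, ∏ j : Fin k, if i < j then |u i - u j| ^ p else 1) = vdm u ^ p := by
  unfold vdm
  rw [← Real.finsetProd_rpow _ _ fun i _ => Finset.prod_nonneg fun j _ => by
    split_ifs <;> positivity]
  refine Finset.prod_congr rfl fun i _ => ?_
  rw [← Real.finsetProd_rpow _ _ fun j _ => by split_ifs <;> positivity]
  refine Finset.prod_congr rfl fun j _ => ?_
  split_ifs <;> simp

lemma abs_det_vandermonde {k : ℕ} (u : Fin k → ℝ) : |(Matrix.vandermonde u).det| = vdm u := by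
  rw [Matrix.det_vandermonde, Finset.abs_prod, vdm]
  refine Finset.prod_congr rfl fun i _ => ?_
  rw [Finset.abs_prod, ← Finset.prod_filter, ← Finset.filter_lt_eq_Ioi]
  exact Finset.prod_congr rfl fun j _ => abs_sub_comm _ _

lemma prod_abs_prod_erase_sub {k : ℕ} (u : Fin k → ℝ) :
    ∏ i, |∏ j ∈ Finset.univ.erase i, (u i - u j)| = vdm u ^ 2 := by
  have h : ∀ i, |∏ j ∈ Finset.univ.erase i, (u i - u j)| =
      (∏ j, if i < j then |u i - u j| else 1) * ∏ j, if j < i then |u j - u i| else 1 := by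
    intro i
    rw [Finset.abs_prod, ← Finset.prod_mul_distrib,
      ← Finset.prod_subset (Finset.erase_subset i Finset.univ)]
    · refine Finset.prod_congr rfl fun j hj => ?_
      rcases lt_or_gt_of_ne (Finset.ne_of_mem_erase hj) with h | h
      · simp [h, h.not_gt, abs_sub_comm]
      · simp [h, h.not_gt]
    · intro j _ hj
      have : j = i := by simpa using hj
      simp [this]
  simp_rw [h]
  rw [Finset.prod_mul_distrib, sq]
  congr 1
  exact Finset.prod_comm

lemma vdm_cons {k : ℕ} (c : ℝ) (u : Fin k → ℝ) :
    vdm (Fin.cons c u : Fin (k + 1) → ℝ) = (∏ r, |c - u r|) * vdm u := by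
  simp [vdm, Fin.prod_univ_succ]

open Polynomial in
/-- Evaluation determinants of a family of polynomials of degree `< m` factor through the
Vandermonde determinant of the nodes. -/
lemma det_eval_eq_det_vandermonde_mul {m : ℕ} (v : Fin m → ℝ) (p : Fin m → ℝ[X])
    (hp : ∀ j, (p j).natDegree < m) :
    (Matrix.of fun i j => (p j).eval (v i)).det =
      (Matrix.vandermonde v).det * (Matrix.of fun i j : Fin m => (p j).coeff i).det := by
  rw [← Matrix.det_mul]
  congr 1
  ext i j
  rw [Matrix.mul_apply, Matrix.of_apply, eval_eq_sum_range' (hp j), ← Fin.sum_univ_eq_sum_range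
    (fun l => (p j).coeff l * v i ^ l)]
  exact Finset.sum_congr rfl fun l _ => by rw [mul_comm]; rfl

open Polynomial in
/-- The polynomials `∏ (X - u r)` and `∏_{r' ≠ r} (X - u r')`. -/
def rootPoly {k : ℕ} (u : Fin k → ℝ) : Fin (k + 1) → ℝ[X] :=
  Fin.cons (∏ r, (X - C (u r))) fun r => ∏ r' ∈ Finset.univ.erase r, (X - C (u r'))

open Polynomial in
lemma natDegree_rootPoly_lt {k : ℕ} (u : Fin k → ℝ) (j : Fin (k + 1)) :
    (rootPoly u j).natDegree < k + 1 := by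
  refine Fin.cases ?_ (fun r => ?_) j
  · simp [rootPoly, natDegree_prod_of_monic _ _ fun r _ => monic_X_sub_C (u r)]
  · simp only [rootPoly, Fin.cons_succ]
    rw [natDegree_prod_of_monic _ _ fun r _ => monic_X_sub_C (u r)]
    simp

lemma degree_rootPoly_lt_card {k : ℕ} (u : Fin k → ℝ) (j : Fin (k + 1)) :
    (rootPoly u j).degree < (Finset.univ : Finset (Fin (k + 1))).card := by
  refine Polynomial.degree_le_natDegree.trans_lt ?_
  rw [Finset.card_univ, Fintype.card_fin]
  exact_mod_cast natDegree_rootPoly_lt u j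

open Polynomial in
lemma coeff_rootPoly_zero {k : ℕ} (u : Fin k → ℝ) : (rootPoly u 0).coeff k = 1 := by
  have hmon : (rootPoly u 0).Monic := by
    simpa [rootPoly] using monic_prod_of_monic Finset.univ _ fun r _ => monic_X_sub_C (u r)
  have hdeg : (rootPoly u 0).natDegree = k := by
    simp [rootPoly, natDegree_prod_of_monic _ _ fun r _ => monic_X_sub_C (u r)]
  rwa [Monic, leadingCoeff, hdeg] at hmon

lemma eval_rootPoly_zero {k : ℕ} (u : Fin k → ℝ) (x : ℝ) :
    (rootPoly u 0).eval x = ∏ r, (x - u r) := by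
  simp [rootPoly, Polynomial.eval_prod]

lemma eval_rootPoly_succ {k : ℕ} (u : Fin k → ℝ) (x : ℝ) (r : Fin k) :
    (rootPoly u r.succ).eval x = ∏ r' ∈ Finset.univ.erase r, (x - u r') := by
  simp [rootPoly, Polynomial.eval_prod]

lemma abs_det_eval_rootPoly {k : ℕ} (b : Fin (k + 1) → ℝ) {u : Fin k → ℝ} (hu : StrictAnti u) :
    |(Matrix.of fun i j => (rootPoly u j).eval (b i)).det| = vdm b * vdm u := by
  obtain ⟨c, hc⟩ : ∃ c, ∀ r, u r < c := by
    obtain ⟨c, hc⟩ := (Set.finite_range u).bddAbove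
    exact ⟨c + 1, fun r => (hc ⟨r, rfl⟩).trans_lt (lt_add_one c)⟩
  set C := (Matrix.of fun i j : Fin (k + 1) => (rootPoly u j).coeff i).det with hC
  have hfac : ∀ v : Fin (k + 1) → ℝ,
      |(Matrix.of fun i j => (rootPoly u j).eval (v i)).det| = vdm v * |C| := fun v => by
    rw [det_eval_eq_det_vandermonde_mul v _ (natDegree_rootPoly_lt u), abs_mul,
      abs_det_vandermonde]
  have htri : |(Matrix.of fun i j => (rootPoly u j).eval
      ((Fin.cons c u : Fin (k + 1) → ℝ) i)).det| = (∏ r, |c - u r|) * vdm u ^ 2 := by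
    rw [Matrix.det_of_isUpperTriangular, Finset.abs_prod, Fin.prod_univ_succ]
    · simp only [Matrix.of_apply, Fin.cons_zero, Fin.cons_succ, eval_rootPoly_zero,
        eval_rootPoly_succ, prod_abs_prod_erase_sub, Finset.abs_prod (f := fun r => c - u r)]
    · intro i j hij
      obtain ⟨i, rfl⟩ := Fin.exists_succ_eq.2 (Fin.ne_zero_of_lt hij)
      refine Fin.cases ?_ (fun r hr => ?_) j hij
      · intro _
        simp only [Matrix.of_apply, Fin.cons_succ, eval_rootPoly_zero]
        exact Finset.prod_eq_zero (Finset.mem_univ i) (sub_self _)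
      · simp only [Matrix.of_apply, Fin.cons_succ, eval_rootPoly_succ]
        refine Finset.prod_eq_zero (i := i) (Finset.mem_erase.2 ⟨?_, Finset.mem_univ _⟩) (sub_self _)
        rintro rfl
        exact lt_irrefl _ hr
  have hpos : 0 < ∏ r, |c - u r| :=
    Finset.prod_pos fun r _ => abs_pos.2 (sub_pos.2 (hc r)).ne'
  have hv := vdm_pos hu
  rw [hfac, vdm_cons] at htri
  have : |C| = vdm u := by
    have h2 : (∏ r, |c - u r|) * vdm u ≠ 0 := (mul_pos hpos hv).ne'
    apply mul_left_cancel₀ h2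
    rw [htri]; ring
  rw [hfac, this]

/-- Given nodes `b`, send `(t, u)` to the residue weights `t ∏ (b s - u r) / ∏_{j ≠ s} (b s - b j)`. -/
def residueMap {k : ℕ} (b y : Fin (k + 1) → ℝ) : Fin (k + 1) → ℝ :=
  fun s => y 0 * (∏ r : Fin k, (b s - y r.succ)) * (∏ j ∈ Finset.univ.erase s, (b s - b j))⁻¹

/-- The Jacobian matrix of `residueMap`. -/
def residueJac {k : ℕ} (b y : Fin (k + 1) → ℝ) : Matrix (Fin (k + 1)) (Fin (k + 1)) ℝ :=
  Matrix.of fun s j => (∏ j ∈ Finset.univ.erase s, (b s - b j))⁻¹ *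
    ((Fin.cons 1 fun _ => - y 0 : Fin (k + 1) → ℝ) j *
      (rootPoly (Fin.tail y) j).eval (b s))

lemma hasFDerivAt_residueMap {k : ℕ} (b y : Fin (k + 1) → ℝ) :
    HasFDerivAt (residueMap b)
      (LinearMap.toContinuousLinearMap (Matrix.toLin' (residueJac b y))) y := by
  rw [hasFDerivAt_pi']
  intro s
  have h0 : HasFDerivAt (fun y : Fin (k + 1) → ℝ => y 0)
      (ContinuousLinearMap.proj (R := ℝ) (φ := fun _ : Fin (k + 1) => ℝ) 0) y :=
    hasFDerivAt_apply 0 y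
  have hr : ∀ r ∈ (Finset.univ : Finset (Fin k)),
      HasFDerivAt (fun y : Fin (k + 1) → ℝ => b s - y r.succ)
      (-ContinuousLinearMap.proj (R := ℝ) (φ := fun _ : Fin (k + 1) => ℝ) r.succ) y :=
    fun r _ => (hasFDerivAt_apply r.succ y).const_sub (b s)
  have h := (h0.mul (HasFDerivAt.finsetProd hr)).mul_const
    (∏ j ∈ Finset.univ.erase s, (b s - b j))⁻¹
  refine h.congr_fderiv ?_
  ext v
  simp [residueJac, Matrix.mulVec, dotProduct, Fin.sum_univ_succ, eval_rootPoly_zero,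
    eval_rootPoly_succ, Fin.tail, Finset.mul_sum]
  rw [add_comm]
  congr 1
  · ring
  · exact congrArg _ (Finset.sum_congr rfl fun r _ => by ring)

lemma abs_det_residueJac {k : ℕ} {b y : Fin (k + 1) → ℝ} (hb : StrictAnti b)
    (hy : StrictAnti (Fin.tail y)) (h0 : 0 < y 0) :
    |(residueJac b y).det| = y 0 ^ k * vdm (Fin.tail y) * (vdm b)⁻¹ := by
  have : residueJac b y = Matrix.of fun s j => (∏ j ∈ Finset.univ.erase s, (b s - b j))⁻¹ *
      (Matrix.of fun s j => (Fin.cons 1 fun _ => - y 0 : Fin (k + 1) → ℝ) j *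
      (Matrix.of fun s j => (rootPoly (Fin.tail y) j).eval (b s)) s j) s j := rfl
  rw [this, Matrix.det_mul_column, Matrix.det_mul_row, abs_mul, abs_mul,
    abs_det_eval_rootPoly b hy, Finset.abs_prod]
  simp_rw [abs_inv]
  rw [Finset.prod_inv_distrib, prod_abs_prod_erase_sub, Fin.prod_univ_succ]
  have := (vdm_pos hb).ne'
  simp [abs_of_pos h0]
  field_simp

lemma sum_residueMap {k : ℕ} {b : Fin (k + 1) → ℝ} (hb : StrictAnti b) (y : Fin (k + 1) → ℝ) :
    ∑ s, residueMap b y s = y 0 := by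
  have h := Lagrange.coeff_eq_sum (s := Finset.univ) (v := b) hb.injective.injOn
    (degree_rootPoly_lt_card (Fin.tail y) 0)
  simp only [Finset.card_univ, Fintype.card_fin, Nat.add_sub_cancel, coeff_rootPoly_zero,
    eval_rootPoly_zero] at h
  simp only [residueMap, mul_assoc]
  rw [← Finset.mul_sum]
  simp only [Fin.tail, div_eq_mul_inv] at h
  rw [← h, mul_one]

/-- The set of `(t, u)` with `t > 0` and `u ≺ b`. -/
def residueDomain {k : ℕ} (b : Fin (k + 1) → ℝ) : Set (Fin (k + 1) → ℝ) :=
  {y | 0 < y 0 ∧ Interlaces (Fin.tail y) b}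

lemma Interlaces.strictAnti_right {k : ℕ} {u : Fin k → ℝ} {v : Fin (k + 1) → ℝ}
    (h : Interlaces u v) : StrictAnti v :=
  Fin.strictAnti_iff_succ_lt.2 fun i => (h i).2.trans (h i).1

lemma Interlaces.strictAnti_left {k : ℕ} {u : Fin k → ℝ} {v : Fin (k + 1) → ℝ}
    (h : Interlaces u v) : StrictAnti u := by
  intro i j hij
  have h1 : v j.castSucc ≤ v i.succ :=
    h.strictAnti_right.antitone (by rw [Fin.le_def]; simpa using hij)
  exact (h j).1.trans_le (h1.trans (h i).2.le)

lemma Interlaces.index_eq {k : ℕ} {u u' : Fin k → ℝ} {b : Fin (k + 1) → ℝ}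
    (h : Interlaces u b) (h' : Interlaces u' b) {i j : Fin k} (hij : u i = u' j) : i = j := by
  have hb := h.strictAnti_right
  have h1 : b i.succ < b j.castSucc := (h i).2.trans (hij ▸ (h' j).1)
  have h2 : b j.succ < b i.castSucc := (h' j).2.trans (hij ▸ (h i).1)
  rw [hb.lt_iff_gt, Fin.lt_def] at h1 h2
  simp at h1 h2
  omega

open Polynomial in
lemma injOn_residueMap {k : ℕ} (b : Fin (k + 1) → ℝ) (hb : StrictAnti b) :
    Set.InjOn (residueMap b) (residueDomain b) := by
  intro y hy y' hy' h
  have h0 : y 0 = y' 0 := by rw [← sum_residueMap hb y, ← sum_residueMap hb y', h]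
  have hp : rootPoly (Fin.tail y) 0 = rootPoly (Fin.tail y') 0 := by
    refine eq_of_degrees_lt_of_eval_index_eq (Finset.univ) (v := b) hb.injective.injOn ?_ ?_ ?_
    · exact degree_rootPoly_lt_card (Fin.tail y) 0
    · exact degree_rootPoly_lt_card (Fin.tail y') 0
    · intro s _
      have hs := congrFun h s
      have hD : (∏ j ∈ Finset.univ.erase s, (b s - b j))⁻¹ ≠ 0 :=
        inv_ne_zero (Finset.prod_ne_zero_iff.2 fun j hj =>
          sub_ne_zero.2 (hb.injective.ne (Finset.ne_of_mem_erase hj).symm))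
      simp only [residueMap, ← h0] at hs
      simpa [eval_rootPoly_zero, Fin.tail, hy.1.ne'] using
        mul_left_cancel₀ hy.1.ne' (mul_right_cancel₀ hD hs)
  funext j
  refine Fin.cases h0 (fun r => ?_) j
  have hr : (rootPoly (Fin.tail y') 0).eval (Fin.tail y r) = 0 := by
    rw [← hp, eval_rootPoly_zero]
    exact Finset.prod_eq_zero (Finset.mem_univ r) (sub_self _)
  rw [eval_rootPoly_zero, Finset.prod_eq_zero_iff] at hr
  obtain ⟨r', -, hr'⟩ := hr
  have := hy.2.index_eq hy'.2 (sub_eq_zero.1 hr')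
  subst this
  exact sub_eq_zero.1 hr'

lemma prod_univ_erase_eq_prod_succAbove {k : ℕ} (s : Fin (k + 1)) (f : Fin (k + 1) → ℝ) :
    ∏ j ∈ Finset.univ.erase s, f j = ∏ r : Fin k, f (s.succAbove r) := by
  rw [← Finset.compl_singleton, ← Fin.image_succAbove_univ,
    Finset.prod_image Fin.succAbove_right_injective.injOn]

lemma residueMap_pos {k : ℕ} {b y : Fin (k + 1) → ℝ} (hy : y ∈ residueDomain b)
    (s : Fin (k + 1)) : 0 < residueMap b y s := by
  have hb := hy.2.strictAnti_right
  rw [residueMap, prod_univ_erase_eq_prod_succAbove, mul_assoc, ← Finset.prod_inv_distrib,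
    ← Finset.prod_mul_distrib]
  refine mul_pos hy.1 (Finset.prod_pos fun r _ => ?_)
  have h := hy.2 r
  simp only [Fin.tail] at h
  rcases lt_or_ge r.castSucc s with hr | hr
  · rw [Fin.succAbove_of_castSucc_lt _ _ hr]
    have h1 : b s ≤ b r.succ := hb.antitone (Fin.castSucc_lt_iff_succ_le.1 hr)
    exact mul_pos_of_neg_of_neg (by linarith) (inv_neg''.2 (by linarith [hb hr]))
  · rw [Fin.succAbove_of_le_castSucc _ _ hr]
    have h1 : b r.castSucc ≤ b s := hb.antitone hr
    exact mul_pos (by linarith) (inv_pos.2 (by linarith [h.1, h.2]))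

lemma prod_erase_sub_mul_neg {k : ℕ} {b : Fin (k + 1) → ℝ} (hb : StrictAnti b) (r : Fin k) :
    (∏ j ∈ Finset.univ.erase r.castSucc, (b r.castSucc - b j)) *
      ∏ j ∈ Finset.univ.erase r.succ, (b r.succ - b j) < 0 := by
  have hne : r.castSucc ≠ r.succ := Fin.castSucc_lt_succ.ne
  have hlt : b r.succ < b r.castSucc := hb Fin.castSucc_lt_succ
  rw [← Finset.mul_prod_erase (Finset.univ.erase r.castSucc) _
      (Finset.mem_erase.2 ⟨hne.symm, Finset.mem_univ _⟩),
    ← Finset.mul_prod_erase (Finset.univ.erase r.succ) _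
      (Finset.mem_erase.2 ⟨hne, Finset.mem_univ _⟩),
    Finset.erase_right_comm (a := r.succ), mul_mul_mul_comm, ← Finset.prod_mul_distrib]
  refine mul_neg_of_neg_of_pos (mul_neg_of_pos_of_neg (by linarith) (by linarith))
    (Finset.prod_pos fun j hj => ?_)
  simp only [Finset.mem_erase] at hj
  rcases lt_or_ge j r.castSucc with h | h
  · have h1 := hb h
    exact mul_pos_of_neg_of_neg (by linarith) (by linarith)
  · have h2 : r.castSucc < j := lt_of_le_of_ne h hj.2.1.symm
    have h3 : r.succ < j := lt_of_le_of_ne (Fin.castSucc_lt_iff_succ_le.1 h2) hj.1.symm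
    have h1 := hb h3
    exact mul_pos (by linarith) (by linarith)

open Polynomial in
lemma exists_residueMap_eq {k : ℕ} {b : Fin (k + 1) → ℝ} (hb : StrictAnti b)
    {w : Fin (k + 1) → ℝ} (hw : ∀ s, 0 < w s) : ∃ y ∈ residueDomain b, residueMap b y = w := by
  set D : Fin (k + 1) → ℝ := fun s => ∏ j ∈ Finset.univ.erase s, (b s - b j) with hDdef
  have hD : ∀ s, D s ≠ 0 := fun s => Finset.prod_ne_zero_iff.2 fun j hj =>
    sub_ne_zero.2 (hb.injective.ne (Finset.ne_of_mem_erase hj).symm)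
  have hinj : Set.InjOn b (Finset.univ : Finset (Fin (k + 1))) := hb.injective.injOn
  set P : ℝ[X] := Lagrange.interpolate Finset.univ b fun s => w s * D s with hP
  have hPev : ∀ s, P.eval (b s) = w s * D s := fun s =>
    Lagrange.eval_interpolate_at_node _ hinj (Finset.mem_univ s)
  have hPdeg : P.degree < (Finset.univ : Finset (Fin (k + 1))).card :=
    Lagrange.degree_interpolate_lt _ hinj
  have hroot : ∀ r : Fin k, ∃ x, (x < b r.castSucc ∧ b r.succ < x) ∧ P.eval x = 0 := by
    intro r
    have hlt : b r.succ < b r.castSucc := hb Fin.castSucc_lt_succ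
    have hsign : P.eval (b r.castSucc) * P.eval (b r.succ) < 0 := by
      rw [hPev, hPev, mul_mul_mul_comm]
      exact mul_neg_of_pos_of_neg (mul_pos (hw _) (hw _)) (prod_erase_sub_mul_neg hb r)
    have hc : ContinuousOn (fun x => P.eval x) (Set.Icc (b r.succ) (b r.castSucc)) :=
      P.continuous.continuousOn
    rcases mul_neg_iff.1 hsign with ⟨h1, h2⟩ | ⟨h1, h2⟩
    · obtain ⟨x, hx, hx0⟩ := intermediate_value_Ioo hlt.le hc ⟨h2, h1⟩
      exact ⟨x, ⟨hx.2, hx.1⟩, hx0⟩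
    · obtain ⟨x, hx, hx0⟩ := intermediate_value_Ioo' hlt.le hc ⟨h1, h2⟩
      exact ⟨x, ⟨hx.2, hx.1⟩, hx0⟩
  choose u hu hu0 using hroot
  have hui : Interlaces u b := hu
  set t := ∑ s, w s with ht
  have hPk : P.coeff k = t := by
    have h := Lagrange.coeff_eq_sum hinj hPdeg
    simp only [Finset.card_univ, Fintype.card_fin, Nat.add_sub_cancel] at h
    rw [h]
    refine Finset.sum_congr rfl fun s _ => ?_
    rw [hPev]
    exact mul_div_cancel_right₀ _ (hD s)
  have hPeq : P = C t * rootPoly u 0 := by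
    rw [← sub_eq_zero]
    refine eq_zero_of_degree_lt_of_eval_index_eq_zero Finset.univ (v := u)
      hui.strictAnti_left.injective.injOn ?_ ?_
    · rw [Finset.card_univ, Fintype.card_fin, degree_lt_iff_coeff_zero]
      intro m hm
      rw [coeff_sub, coeff_C_mul]
      rcases hm.eq_or_lt with rfl | hm
      · rw [hPk, coeff_rootPoly_zero, mul_one, sub_self]
      · rw [coeff_eq_zero_of_degree_lt, coeff_eq_zero_of_degree_lt, mul_zero, sub_zero]
        · refine (degree_rootPoly_lt_card u 0).trans_le ?_
          rw [Finset.card_univ, Fintype.card_fin]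
          exact_mod_cast hm
        · refine hPdeg.trans_le ?_
          rw [Finset.card_univ, Fintype.card_fin]
          exact_mod_cast hm
    · intro r _
      rw [eval_sub, hu0, eval_mul, eval_rootPoly_zero,
        Finset.prod_eq_zero (Finset.mem_univ r) (sub_self _), mul_zero, sub_zero]
  refine ⟨Fin.cons t u, ⟨?_, by simpa [Fin.tail_cons] using hui⟩, ?_⟩
  · exact Finset.sum_pos (fun s _ => hw s) ⟨0, Finset.mem_univ _⟩
  · funext s
    have h := hPev s
    rw [hPeq, eval_mul, eval_C, eval_rootPoly_zero] at h
    simp only [residueMap, Fin.cons_zero, Fin.cons_succ]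
    rw [h]
    exact mul_inv_cancel_right₀ (hD s) _

lemma image_residueMap {k : ℕ} {b : Fin (k + 1) → ℝ} (hb : StrictAnti b) :
    residueMap b '' residueDomain b = {w | ∀ s, 0 < w s} := by
  ext w
  constructor
  · rintro ⟨y, hy, rfl⟩
    exact residueMap_pos hy
  · exact fun hw => exists_residueMap_eq hb hw

/-- The Gamma integrand, extended by zero. -/
def gammaFn (θ x : ℝ) : ℝ := (Set.Ioi (0 : ℝ)).indicator (fun x => Real.exp (-x) * x ^ (θ - 1)) x

lemma gammaFn_nonneg (θ x : ℝ) : 0 ≤ gammaFn θ x :=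
  Set.indicator_nonneg (fun _ hx => mul_nonneg (Real.exp_pos _).le
    (Real.rpow_nonneg (le_of_lt hx) _)) x

lemma measurable_gammaFn (θ : ℝ) : Measurable (gammaFn θ) :=
  Measurable.indicator (by fun_prop) measurableSet_Ioi

lemma integrable_gammaFn {θ : ℝ} (hθ : 0 < θ) : Integrable (gammaFn θ) :=
  (integrable_indicator_iff measurableSet_Ioi).2 (Real.GammaIntegral_convergent hθ)

lemma integral_gammaFn {θ : ℝ} (hθ : 0 < θ) : ∫ x, gammaFn θ x = Real.Gamma θ := by
  rw [Real.Gamma_eq_integral hθ]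
  exact integral_indicator measurableSet_Ioi

lemma lintegral_gammaFn {θ : ℝ} (hθ : 0 < θ) :
    ∫⁻ x, ENNReal.ofReal (gammaFn θ x) = ENNReal.ofReal (Real.Gamma θ) := by
  rw [← integral_gammaFn hθ, ofReal_integral_eq_lintegral_ofReal (integrable_gammaFn hθ)
    (ae_of_all _ (gammaFn_nonneg θ))]

lemma lintegral_prod_gammaFn {θ : ℝ} (hθ : 0 < θ) (k : ℕ) :
    ∫⁻ w : Fin k → ℝ, ENNReal.ofReal (∏ s, gammaFn θ (w s)) =
      ENNReal.ofReal (Real.Gamma θ ^ k) := by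
  have hint : Integrable fun w : Fin k → ℝ => ∏ s, gammaFn θ (w s) :=
    Integrable.fintype_prod fun _ => integrable_gammaFn hθ
  rw [← ofReal_integral_eq_lintegral_ofReal hint
    (ae_of_all _ fun w => Finset.prod_nonneg fun s _ => gammaFn_nonneg θ (w s)),
    integral_fintype_prod_volume_eq_pow, integral_gammaFn hθ, Fintype.card_fin]

lemma prod_prod_abs_sub_rpow {k m : ℕ} (b : Fin m → ℝ) (u : Fin k → ℝ) (p : ℝ) :
    ∏ s, ∏ r, |b s - u r| ^ p = (∏ s, ∏ r, |b s - u r|) ^ p := by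
  rw [← Real.finsetProd_rpow _ _ fun s _ => Finset.prod_nonneg fun r _ => abs_nonneg _]
  exact Finset.prod_congr rfl fun s _ => Real.finsetProd_rpow _ _ (fun r _ => abs_nonneg _) _

lemma measurableSet_interlaces {k : ℕ} :
    MeasurableSet {p : (Fin k → ℝ) × (Fin (k + 1) → ℝ) | Interlaces p.1 p.2} := by
  simp only [Interlaces, Set.ofPred_forall]
  refine MeasurableSet.iInter fun i => ?_
  have h1 : MeasurableSet {p : (Fin k → ℝ) × (Fin (k + 1) → ℝ) | p.1 i < p.2 i.castSucc} :=
    measurableSet_lt (by fun_prop) (by fun_prop)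
  have h2 : MeasurableSet {p : (Fin k → ℝ) × (Fin (k + 1) → ℝ) | p.2 i.succ < p.1 i} :=
    measurableSet_lt (by fun_prop) (by fun_prop)
  exact h1.inter h2

lemma measurableSet_interlaces_left {k : ℕ} (b : Fin (k + 1) → ℝ) :
    MeasurableSet {u | Interlaces u b} :=
  measurableSet_interlaces.preimage (f := fun u => (u, b)) (by fun_prop)

lemma prod_residueMap {k : ℕ} {b y : Fin (k + 1) → ℝ} (hy : y ∈ residueDomain b) :
    ∏ s, residueMap b y s =
      y 0 ^ (k + 1) * (∏ s, ∏ r, |b s - Fin.tail y r|) * (vdm b ^ 2)⁻¹ := by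
  rw [← prod_abs_prod_erase_sub, ← Finset.prod_inv_distrib]
  rw [Finset.prod_congr rfl fun s _ => (abs_of_pos (residueMap_pos hy s)).symm]
  simp only [residueMap, abs_mul, abs_inv, Finset.prod_mul_distrib, abs_of_pos hy.1,
    Finset.abs_prod, Fin.tail]
  simp

/-- The integrand transported by `residueMap` splits into a Gamma factor in `t` and the
Dixon–Anderson integrand in `u`. -/
lemma abs_det_residueJac_mul_prod_gammaFn {k : ℕ} {θ : ℝ} {b y : Fin (k + 1) → ℝ}
    (hy : y ∈ residueDomain b) :
    |(residueJac b y).det| * ∏ s, gammaFn θ (residueMap b y s) =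
      gammaFn ((k + 1) * θ) (y 0) *
        (vdm b ^ (1 - 2 * θ) *
          (vdm (Fin.tail y) * ∏ s, ∏ r, |b s - Fin.tail y r| ^ (θ - 1))) := by
  have hb := hy.2.strictAnti_right
  have ht : 0 < y 0 := hy.1
  have hV := vdm_pos hb
  have hgam : ∏ s, gammaFn θ (residueMap b y s) =
      Real.exp (-y 0) * (∏ s, residueMap b y s) ^ (θ - 1) := by
    rw [← sum_residueMap hb y, ← Finset.sum_neg_distrib, Real.exp_sum,
      ← Real.finsetProd_rpow _ _ fun s _ => (residueMap_pos hy s).le,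
      ← Finset.prod_mul_distrib]
    exact Finset.prod_congr rfl fun s _ => Set.indicator_of_mem (residueMap_pos hy s) _
  have hE : 0 ≤ ∏ s, ∏ r, |b s - Fin.tail y r| :=
    Finset.prod_nonneg fun s _ => Finset.prod_nonneg fun r _ => abs_nonneg _
  rw [hgam, prod_residueMap hy, abs_det_residueJac hb hy.2.strictAnti_left ht,
    prod_prod_abs_sub_rpow, gammaFn, Set.indicator_of_mem (show y 0 ∈ Set.Ioi 0 from ht),
    Real.mul_rpow (by positivity) (by positivity), Real.mul_rpow (by positivity) hE]
  have h1 : y 0 ^ ((k + 1) * θ - 1) = y 0 ^ k * (y 0 ^ (k + 1)) ^ (θ - 1) := by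
    rw [← Real.rpow_natCast (y 0) k, ← Real.rpow_natCast (y 0) (k + 1), ← Real.rpow_mul ht.le,
      ← Real.rpow_add ht]
    congr 1; push_cast; ring
  have h2 : vdm b ^ (1 - 2 * θ) = (vdm b)⁻¹ * ((vdm b ^ 2)⁻¹) ^ (θ - 1) := by
    rw [← Real.rpow_natCast (vdm b) 2, ← Real.rpow_neg_one, ← Real.rpow_neg_one (vdm b ^ _),
      ← Real.rpow_mul hV.le, ← Real.rpow_mul hV.le, ← Real.rpow_add hV]
    congr 1; push_cast; ring
  rw [h1, h2]
  ring

lemma measurable_vdm {k : ℕ} : Measurable (vdm (k := k)) := by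
  unfold vdm
  refine Finset.measurable_fun_prod _ fun i _ => Finset.measurable_fun_prod _ fun j _ => ?_
  split_ifs <;> fun_prop

/-- The **Dixon–Anderson integral**. -/
theorem lintegral_dixonAnderson {k : ℕ} {θ : ℝ} (hθ : 0 < θ) {b : Fin (k + 1) → ℝ}
    (hb : StrictAnti b) :
    ∫⁻ u in {u | Interlaces u b},
        ENNReal.ofReal (vdm u * ∏ s, ∏ r, |b s - u r| ^ (θ - 1)) =
      ENNReal.ofReal (Real.Gamma θ ^ (k + 1) / Real.Gamma ((k + 1) * θ) *
        vdm b ^ (2 * θ - 1)) := by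
  have hkθ : 0 < (k + 1) * θ := by positivity
  have hV := vdm_pos hb
  set H : (Fin k → ℝ) → ℝ≥0∞ := {u | Interlaces u b}.indicator
    fun u => ENNReal.ofReal (vdm u * ∏ s, ∏ r, |b s - u r| ^ (θ - 1)) with hH
  have hHm : Measurable H := by
    refine Measurable.indicator ?_ (measurableSet_interlaces_left b)
    have := measurable_vdm (k := k)
    refine ENNReal.measurable_ofReal.comp (this.mul ?_)
    refine Finset.measurable_fun_prod _ fun i _ => Finset.measurable_fun_prod _ fun j _ => ?_
    fun_prop
  have hdom : MeasurableSet (residueDomain b) := by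
    refine (measurableSet_lt measurable_const (measurable_pi_apply 0)).inter ?_
    have htail : Measurable (Fin.tail : (Fin (k + 1) → ℝ) → Fin k → ℝ) :=
      measurable_pi_lambda _ fun r => measurable_pi_apply r.succ
    exact htail (measurableSet_interlaces_left b)
  have hcov := lintegral_image_eq_lintegral_abs_det_fderiv_mul volume hdom
    (fun y _ => (hasFDerivAt_residueMap b y).hasFDerivWithinAt) (injOn_residueMap b hb)
    fun w => ENNReal.ofReal (∏ s, gammaFn θ (w s))
  have hleft : ∫⁻ w in residueMap b '' residueDomain b, ENNReal.ofReal (∏ s, gammaFn θ (w s)) =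
      ENNReal.ofReal (Real.Gamma θ ^ (k + 1)) := by
    rw [image_residueMap hb, ← lintegral_prod_gammaFn hθ]
    refine setLIntegral_eq_of_support_subset fun w hw s => ?_
    by_contra hs
    have h0 : ∏ s, gammaFn θ (w s) = 0 :=
      Finset.prod_eq_zero (Finset.mem_univ s) (by simp [gammaFn, hs])
    exact hw (by simp [h0])
  have hright : ∫⁻ y in residueDomain b, ENNReal.ofReal
        |(LinearMap.toContinuousLinearMap (Matrix.toLin' (residueJac b y))).det| *
        ENNReal.ofReal (∏ s, gammaFn θ (residueMap b y s)) =
      ENNReal.ofReal (vdm b ^ (1 - 2 * θ)) *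
        (ENNReal.ofReal (Real.Gamma ((k + 1) * θ)) * ∫⁻ u, H u) := by
    have hpt : ∀ y ∈ residueDomain b, ENNReal.ofReal
        |(LinearMap.toContinuousLinearMap (Matrix.toLin' (residueJac b y))).det| *
        ENNReal.ofReal (∏ s, gammaFn θ (residueMap b y s)) =
        ENNReal.ofReal (vdm b ^ (1 - 2 * θ)) *
          (ENNReal.ofReal (gammaFn ((k + 1) * θ) (y 0)) * H (Fin.tail y)) := by
      intro y hy
      rw [hH, Set.indicator_of_mem (show Fin.tail y ∈ {u | Interlaces u b} from hy.2),
        ← ENNReal.ofReal_mul (abs_nonneg _), ContinuousLinearMap.det,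
        LinearMap.coe_toContinuousLinearMap, LinearMap.det_toLin',
        abs_det_residueJac_mul_prod_gammaFn hy, ENNReal.ofReal_mul (gammaFn_nonneg _ _),
        ENNReal.ofReal_mul (by positivity)]
      ring
    rw [setLIntegral_congr_fun hdom hpt, ← lintegral_indicator hdom]
    have hind : (residueDomain b).indicator (fun y => ENNReal.ofReal (vdm b ^ (1 - 2 * θ)) *
          (ENNReal.ofReal (gammaFn ((k + 1) * θ) (y 0)) * H (Fin.tail y))) =
        fun y => ENNReal.ofReal (vdm b ^ (1 - 2 * θ)) *
          (ENNReal.ofReal (gammaFn ((k + 1) * θ) (y 0)) * H (Fin.tail y)) := by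
      rw [Set.indicator_eq_self]
      intro y hy
      simp only [Function.mem_support, ne_eq, mul_eq_zero, not_or] at hy
      refine ⟨?_, Set.mem_of_indicator_ne_zero hy.2.2⟩
      by_contra h
      exact hy.2.1 (by simp [gammaFn, h])
    rw [hind, lintegral_const_mul' _ _ ENNReal.ofReal_ne_top,
      ← lintegral_gammaFn hkθ, ← lintegral_prod_mul
        (measurable_gammaFn _).ennreal_ofReal.aemeasurable hHm.aemeasurable]
    congr 1
    exact ((volume_preserving_piFinSuccAbove (fun _ : Fin (k + 1) => ℝ) 0).lintegral_comp_emb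
      (MeasurableEquiv.measurableEmbedding _)
      fun p => ENNReal.ofReal (gammaFn ((k + 1) * θ) p.1) * H p.2)
  rw [hleft, hright] at hcov
  rw [← lintegral_indicator (measurableSet_interlaces_left b)]
  have hG := Real.Gamma_pos_of_pos hkθ
  have hc : 0 < vdm b ^ (1 - 2 * θ) * Real.Gamma ((k + 1) * θ) := by positivity
  rw [← mul_assoc, ← ENNReal.ofReal_mul (by positivity)] at hcov
  refine (ENNReal.mul_right_inj (ENNReal.ofReal_pos.2 hc).ne' ENNReal.ofReal_ne_top).1
    (hcov.symm.trans ?_)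
  rw [← ENNReal.ofReal_mul hc.le]
  congr 1
  have : vdm b ^ (1 - 2 * θ) * vdm b ^ (2 * θ - 1) = 1 := by
    rw [← Real.rpow_add hV]; simp
  field_simp
  linear_combination -this

open Classical in
/-- The weight attached to two consecutive levels `u ≺ v`, extended by zero. -/
def pairWt (θ : ℝ) {k : ℕ} (u : Fin k → ℝ) (v : Fin (k + 1) → ℝ) : ℝ≥0∞ :=
  if Interlaces u v then
    ENNReal.ofReal (vdm u ^ (2 - 2 * θ) * ∏ s, ∏ r, |v s - u r| ^ (θ - 1))
  else 0

lemma measurable_pairWt (θ : ℝ) (k : ℕ) :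
    Measurable fun p : (Fin k → ℝ) × (Fin (k + 1) → ℝ) => pairWt θ p.1 p.2 := by
  refine Measurable.ite measurableSet_interlaces ?_ measurable_const
  have := measurable_vdm (k := k)
  refine ENNReal.measurable_ofReal.comp (Measurable.mul (by fun_prop) ?_)
  refine Finset.measurable_fun_prod _ fun i _ => Finset.measurable_fun_prod _ fun j _ => ?_
  fun_prop

/-- Append a top level to a triangular array. -/
def snocTri {m : ℕ} (x : Tri m) (v : Fin (m + 1) → ℝ) : Tri (m + 1) := fun k =>
  if h : k.1 < m then x ⟨k.1, h⟩ else fun i => v ⟨i.1, by omega⟩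

lemma snocTri_of_lt {m : ℕ} (x : Tri m) (v : Fin (m + 1) → ℝ) {j : ℕ} (hj : j < m)
    (hj' : j < m + 1) : snocTri x v ⟨j, hj'⟩ = x ⟨j, hj⟩ := dif_pos hj

lemma snocTri_last {m : ℕ} (x : Tri m) (v : Fin (m + 1) → ℝ) (hm : m < m + 1) :
    snocTri x v ⟨m, hm⟩ = v := dif_neg (lt_irrefl m)

lemma measurePreserving_snocTri (m : ℕ) :
    MeasurePreserving (fun p : Tri m × (Fin (m + 1) → ℝ) => snocTri p.1 p.2) := by
  have hmeas : Measurable fun p : Tri m × (Fin (m + 1) → ℝ) => snocTri p.1 p.2 := by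
    refine measurable_pi_lambda _ fun k => ?_
    unfold snocTri
    split_ifs with h
    · fun_prop
    · fun_prop
  refine ⟨hmeas, (Measure.pi_eq fun s hs => ?_).symm⟩
  rw [Measure.map_apply hmeas (MeasurableSet.univ_pi hs)]
  have : (fun p : Tri m × (Fin (m + 1) → ℝ) => snocTri p.1 p.2) ⁻¹' Set.univ.pi s =
      (Set.univ.pi fun k : Fin m => s k.castSucc) ×ˢ s (Fin.last m) := by
    ext ⟨x, v⟩
    simp only [Set.mem_preimage, Set.mem_univ_pi, Set.mem_prod]
    constructor
    · intro h
      refine ⟨fun k => ?_, ?_⟩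
      · have := h k.castSucc
        rwa [show snocTri x v k.castSucc = x k from snocTri_of_lt x v k.2 _] at this
      · have := h (Fin.last m)
        rwa [show snocTri x v (Fin.last m) = v from snocTri_last x v _] at this
    · rintro ⟨h1, h2⟩ k
      refine Fin.lastCases ?_ (fun k => ?_) k
      · rwa [show snocTri x v (Fin.last m) = v from snocTri_last x v _]
      · rw [show snocTri x v k.castSucc = x k from snocTri_of_lt x v k.2 _]
        exact h1 k
  rw [this, Measure.volume_eq_prod, Measure.prod_prod, Fin.prod_univ_castSucc, volume_pi,
    Measure.pi_pi]

lemma lintegral_tri_succ {m : ℕ} {F : Tri (m + 1) → ℝ≥0∞} (hF : Measurable F) :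
    ∫⁻ y, F y = ∫⁻ v, ∫⁻ x, F (snocTri x v) := by
  have h : Measurable fun p : Tri m × (Fin (m + 1) → ℝ) => F (snocTri p.1 p.2) :=
    hF.comp (measurePreserving_snocTri m).measurable
  rw [← (measurePreserving_snocTri m).lintegral_comp hF, Measure.volume_eq_prod]
  exact lintegral_prod_symm _ h.aemeasurable

/-- The product of the weights of consecutive levels of a triangular array. -/
def lowWt (θ : ℝ) (n : ℕ) (y : Tri (n + 1)) : ℝ≥0∞ :=
  ∏ k : Fin n, pairWt θ (y ⟨k.1, by omega⟩) (y ⟨k.1 + 1, by omega⟩)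

lemma measurable_lowWt (θ : ℝ) (n : ℕ) : Measurable (lowWt θ n) := by
  refine Finset.measurable_fun_prod _ fun k _ => ?_
  have h : Measurable fun y : Tri (n + 1) =>
      (y ⟨k.1, by omega⟩, y ⟨k.1 + 1, by omega⟩) :=
    (measurable_pi_apply _).prodMk (measurable_pi_apply _)
  exact (measurable_pairWt θ (k.1 + 1)).comp h

lemma lowWt_succ_snocTri (θ : ℝ) (n : ℕ) (x : Tri (n + 1)) (v : Fin (n + 2) → ℝ) :
    lowWt θ (n + 1) (snocTri x v) = lowWt θ n x * pairWt θ (x ⟨n, by omega⟩) v := by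
  rw [lowWt, Fin.prod_univ_castSucc]
  congr 1
  · refine Finset.prod_congr rfl fun k _ => ?_
    exact congrArg₂ (pairWt θ) (snocTri_of_lt x v (by simp) _)
      (snocTri_of_lt x v (by simp) _)
  · exact congrArg₂ (pairWt θ) (snocTri_of_lt x v (by simp) _) (snocTri_last x v _)

/-- The normalizing constant of the `θ`-Gibbs density. -/
def gibbsConst (θ : ℝ) (n : ℕ) : ℝ :=
  Real.Gamma θ ^ ((n + 1) * (n + 2) / 2) / ∏ k : Fin (n + 1), Real.Gamma ((k.1 + 1) * θ)

lemma gibbsConst_pos {θ : ℝ} (hθ : 0 < θ) (n : ℕ) : 0 < gibbsConst θ n :=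
  div_pos (pow_pos (Real.Gamma_pos_of_pos hθ) _)
    (Finset.prod_pos fun k _ => Real.Gamma_pos_of_pos (by positivity))

lemma gibbsConst_succ (θ : ℝ) (n : ℕ) :
    gibbsConst θ (n + 1) =
      gibbsConst θ n * (Real.Gamma θ ^ (n + 2) / Real.Gamma ((n + 2) * θ)) := by
  have h : (n + 1 + 1) * (n + 1 + 2) / 2 = (n + 1) * (n + 2) / 2 + (n + 2) := by
    rw [show (n + 1 + 1) * (n + 1 + 2) = (n + 1) * (n + 2) + (n + 2) * 2 by ring,
      Nat.add_mul_div_right _ _ two_pos]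
  rw [gibbsConst, gibbsConst, h, pow_add, Fin.prod_univ_castSucc, div_mul_div_comm]
  simp only [Fin.val_castSucc, Fin.val_last]
  congr 4
  push_cast
  ring

/-- Integrating out all levels below the top one. -/
theorem lintegral_lowWt_snocTri {θ : ℝ} (hθ : 0 < θ) (n : ℕ) {v : Fin (n + 1) → ℝ}
    (hv : StrictAnti v) :
    ∫⁻ x, lowWt θ n (snocTri x v) = ENNReal.ofReal (gibbsConst θ n * vdm v ^ (2 * θ - 1)) := by
  induction n with
  | zero =>
    have h1 : gibbsConst θ 0 = 1 := by
      simp [gibbsConst, (Real.Gamma_pos_of_pos hθ).ne']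
    have h2 : vdm v = 1 := by simp [vdm]
    have : (volume : Measure (Tri 0)) Set.univ = 1 := by
      rw [volume_pi, Measure.pi_univ]; simp
    simp [lowWt, h1, h2, this]
  | succ n ih =>
    have hm : Measurable fun x : Tri (n + 1) => lowWt θ (n + 1) (snocTri x v) :=
      (measurable_lowWt θ (n + 1)).comp
        ((measurePreserving_snocTri (n + 1)).measurable.comp (by fun_prop :
          Measurable fun x : Tri (n + 1) => (x, v)))
    have hpt : ∀ u : Fin (n + 1) → ℝ, ∫⁻ x, lowWt θ (n + 1) (snocTri (snocTri x u) v) =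
        {u | Interlaces u v}.indicator (fun u => ENNReal.ofReal (gibbsConst θ n) *
          ENNReal.ofReal (vdm u * ∏ s, ∏ r, |v s - u r| ^ (θ - 1))) u := by
      intro u
      simp only [lowWt_succ_snocTri, snocTri_last]
      by_cases h : Interlaces u v
      · have hu := vdm_pos h.strictAnti_left
        rw [Set.indicator_of_mem (show u ∈ {u | Interlaces u v} from h),
          lintegral_mul_const', ih h.strictAnti_left, pairWt, if_pos h, ← ENNReal.ofReal_mul,
          ← ENNReal.ofReal_mul]
        · congr 1
          have : vdm u ^ (2 * θ - 1) * vdm u ^ (2 - 2 * θ) = vdm u := by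
            rw [← Real.rpow_add hu]; norm_num
          rw [← mul_assoc, mul_assoc (gibbsConst θ n), this, mul_assoc]
        · exact (gibbsConst_pos hθ n).le
        · exact mul_nonneg (gibbsConst_pos hθ n).le (by positivity)
        · rw [pairWt, if_pos h]; exact ENNReal.ofReal_ne_top
      · rw [Set.indicator_of_notMem (show u ∉ {u | Interlaces u v} from h)]
        simp [pairWt, h]
    rw [lintegral_tri_succ hm]
    simp only [hpt]
    rw [lintegral_indicator (measurableSet_interlaces_left v),
      lintegral_const_mul' _ _ ENNReal.ofReal_ne_top, lintegral_dixonAnderson hθ hv,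
      ← ENNReal.ofReal_mul (gibbsConst_pos hθ n).le, gibbsConst_succ, mul_assoc]
    congr 5
    push_cast
    ring

lemma prod_fin_eq_prod_lt_mul_prod_not_lt {β : Type*} [CommMonoid β] {m M : ℕ} (h : m ≤ M)
    (f : Fin M → β) :
    ∏ k, f k = (∏ k : Fin m, f (k.castLE h)) * ∏ k : {k : Fin M // ¬ k.1 < m}, f k := by
  rw [← Fintype.prod_subtype_mul_prod_subtype (fun k : Fin M => k.1 < m) f]
  congr 1
  exact Fintype.prod_equiv
    ⟨fun k => ⟨k.1.1, k.2⟩, fun k => ⟨k.castLE h, k.2⟩, fun _ => rfl, fun _ => rfl⟩ _ _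
    fun _ => rfl

/-- The levels above the `m`-th one of a triangular array with `M` levels. -/
abbrev UpTri (m M : ℕ) := ∀ k : {k : Fin M // ¬ k.1 < m}, Fin (k.1.1 + 1) → ℝ

/-- Glue the bottom `m` levels and the remaining levels of a triangular array. -/
def glue {m M : ℕ} (y : Tri m) (u : UpTri m M) : Tri M := fun k =>
  if h : k.1 < m then y ⟨k.1, h⟩ else u ⟨k, h⟩

lemma glue_of_lt {m M : ℕ} (y : Tri m) (u : UpTri m M) {j : ℕ} (hj : j < m) (hj' : j < M) :
    glue y u ⟨j, hj'⟩ = y ⟨j, hj⟩ := dif_pos hj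

lemma glue_of_not_lt {m M : ℕ} (y : Tri m) (u : UpTri m M) {k : Fin M} (hk : ¬ k.1 < m) :
    glue y u k = u ⟨k, hk⟩ := dif_neg hk

lemma measurePreserving_glue {m M : ℕ} (hm : m ≤ M) :
    MeasurePreserving (fun p : Tri m × UpTri m M => glue p.1 p.2) := by
  have hmeas : Measurable fun p : Tri m × UpTri m M => glue p.1 p.2 := by
    refine measurable_pi_lambda _ fun k => ?_
    unfold glue
    split_ifs with h
    · fun_prop
    · fun_prop
  refine ⟨hmeas, (Measure.pi_eq fun s hs => ?_).symm⟩
  rw [Measure.map_apply hmeas (MeasurableSet.univ_pi hs)]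
  have : (fun p : Tri m × UpTri m M => glue p.1 p.2) ⁻¹' Set.univ.pi s =
      (Set.univ.pi fun k : Fin m => s (k.castLE hm)) ×ˢ
        Set.univ.pi fun k : {k : Fin M // ¬ k.1 < m} => s k := by
    ext ⟨y, u⟩
    simp only [Set.mem_preimage, Set.mem_univ_pi, Set.mem_prod]
    constructor
    · intro h
      refine ⟨fun k => ?_, fun k => ?_⟩
      · have := h (k.castLE hm)
        rwa [show glue y u (k.castLE hm) = y k from glue_of_lt y u k.2 _] at this
      · have := h k
        rwa [glue_of_not_lt y u k.2] at this
    · rintro ⟨h1, h2⟩ k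
      by_cases hk : k.1 < m
      · rw [show glue y u k = y ⟨k.1, hk⟩ from glue_of_lt y u hk _]
        exact h1 ⟨k.1, hk⟩
      · rw [glue_of_not_lt y u hk]
        exact h2 ⟨k, hk⟩
  rw [this, Measure.volume_eq_prod, Measure.prod_prod, volume_pi, Measure.pi_pi, volume_pi,
    Measure.pi_pi, prod_fin_eq_prod_lt_mul_prod_not_lt hm]

lemma lvl_of_lt {N : ℕ} (a : Fin N → ℝ) (x : Tri (N - 1)) {k : ℕ} (hk : k < N)
    (h : k < N - 1) : lvl a x k hk = x ⟨k, h⟩ := dif_pos h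

lemma measurable_lvl {N : ℕ} (a : Fin N → ℝ) (k : ℕ) (hk : k < N) :
    Measurable fun x : Tri (N - 1) => lvl a x k hk := by
  unfold lvl
  split_ifs <;> fun_prop

lemma ofReal_indicator_obpWt (θ : ℝ) {N : ℕ} (a : Fin N → ℝ) (x : Tri (N - 1)) :
    ENNReal.ofReal ((obpDomain a).indicator (obpWt θ a) x) =
      ∏ k : Fin (N - 1), pairWt θ (x k) (lvl a x (k.1 + 1) (by omega)) := by
  by_cases hx : x ∈ obpDomain a
  · rw [Set.indicator_of_mem hx, obpWt, ENNReal.ofReal_prod_of_nonneg]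
    · refine Finset.prod_congr rfl fun k _ => ?_
      rw [pairWt, if_pos (hx k), prod_abs_sub_rpow]
    · intro k _
      rw [prod_abs_sub_rpow]
      have := vdm_nonneg (x k)
      positivity
  · rw [Set.indicator_of_notMem hx, ENNReal.ofReal_zero]
    have hx' : ¬ ∀ k : Fin (N - 1), Interlaces (x k) (lvl a x (k.1 + 1) (by omega)) := hx
    push Not at hx'
    obtain ⟨k, hk⟩ := hx'
    exact (Finset.prod_eq_zero (Finset.mem_univ k) (if_neg hk)).symm

/-- The product of the weights of consecutive levels, starting from level `n + 1`. -/
def upWt (θ : ℝ) {N : ℕ} (a : Fin N → ℝ) (n : ℕ) (x : Tri (N - 1)) : ℝ≥0∞ :=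
  ∏ k : {k : Fin (N - 1) // ¬ k.1 < n},
    pairWt θ (x k) (lvl a x (k.1.1 + 1) (by omega))

lemma measurable_upWt (θ : ℝ) {N : ℕ} (a : Fin N → ℝ) (n : ℕ) :
    Measurable (upWt θ a n) := by
  refine Finset.measurable_fun_prod _ fun k _ => ?_
  have h : Measurable fun x : Tri (N - 1) => (x k, lvl a x (k.1.1 + 1) (by omega)) :=
    (measurable_pi_apply _).prodMk (measurable_lvl a _ _)
  exact (measurable_pairWt θ (k.1.1 + 1)).comp h

lemma upWt_congr (θ : ℝ) {N : ℕ} (a : Fin N → ℝ) {n : ℕ} {x x' : Tri (N - 1)}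
    (h : ∀ k : Fin (N - 1), n ≤ k.1 → x k = x' k) : upWt θ a n x = upWt θ a n x' := by
  refine Finset.prod_congr rfl fun k _ => ?_
  have h1 : x k = x' k := h k (not_lt.1 k.2)
  have h2 : lvl a x (k.1.1 + 1) (by omega) = lvl a x' (k.1.1 + 1) (by omega) := by
    unfold lvl
    split_ifs with hk
    · rw [h ⟨k.1.1 + 1, hk⟩ (by have := k.2; simp only; omega)]
    · rfl
  rw [h1, h2]

lemma ofReal_indicator_obpWt_glue (θ : ℝ) {N : ℕ} (a : Fin N → ℝ) {n : ℕ} (hn : n < N - 1)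
    (y : Tri (n + 1)) (u : UpTri (n + 1) (N - 1)) :
    ENNReal.ofReal ((obpDomain a).indicator (obpWt θ a) (glue y u)) =
      lowWt θ n y * upWt θ a n (glue (snocTri 0 (y ⟨n, n.lt_succ_self⟩)) u) := by
  rw [ofReal_indicator_obpWt, prod_fin_eq_prod_lt_mul_prod_not_lt hn.le, lowWt]
  congr 1
  · refine Finset.prod_congr rfl fun k _ => ?_
    refine congrArg₂ (pairWt θ) (glue_of_lt y u (by simp) _) ?_
    rw [lvl_of_lt a _ _ (by simp; omega)]
    exact glue_of_lt y u (by simp) _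
  · refine upWt_congr θ a fun k hk => ?_
    obtain ⟨k, hkN⟩ := k
    rcases hk.lt_or_eq with hk | rfl
    · rw [glue_of_not_lt _ _ (by simpa using hk), glue_of_not_lt _ _ (by simpa using hk)]
    · rw [glue_of_lt _ _ n.lt_succ_self, glue_of_lt _ _ n.lt_succ_self, snocTri_last]

/-- The unnormalized density factor carried by the levels above level `n + 1`. -/
def upDensity (θ : ℝ) {N : ℕ} (a : Fin N → ℝ) (n : ℕ) (v : Fin (n + 1) → ℝ) : ℝ≥0∞ :=
  ∫⁻ u : UpTri (n + 1) (N - 1), upWt θ a n (glue (snocTri 0 v) u)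

lemma measurable_upWt_glue_snocTri (θ : ℝ) {N : ℕ} (a : Fin N → ℝ) {n : ℕ} (hn : n < N - 1) :
    Measurable fun p : (Fin (n + 1) → ℝ) × UpTri (n + 1) (N - 1) =>
      upWt θ a n (glue (snocTri 0 p.1) p.2) := by
  have h1 : Measurable fun v : Fin (n + 1) → ℝ => snocTri (0 : Tri n) v :=
    (measurePreserving_snocTri n).measurable.comp
      (by fun_prop : Measurable fun v : Fin (n + 1) → ℝ => ((0 : Tri n), v))
  exact (measurable_upWt θ a n).comp ((measurePreserving_glue (by omega)).measurable.comp
    ((h1.comp measurable_fst).prodMk measurable_snd))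

lemma measurable_upWt_glue (θ : ℝ) {N : ℕ} (a : Fin N → ℝ) {n : ℕ} (hn : n < N - 1)
    (y : Tri (n + 1)) :
    Measurable fun u : UpTri (n + 1) (N - 1) => upWt θ a n (glue y u) := by
  have h : Measurable fun u : UpTri (n + 1) (N - 1) => (y, u) := by fun_prop
  exact (measurable_upWt θ a n).comp ((measurePreserving_glue (by omega)).measurable.comp h)

lemma measurable_upDensity (θ : ℝ) {N : ℕ} (a : Fin N → ℝ) {n : ℕ} (hn : n < N - 1) :
    Measurable (upDensity θ a n) :=
  (measurable_upWt_glue_snocTri θ a hn).lintegral_prod_right'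

lemma measurable_triProj {N : ℕ} (m : ℕ) (h : m < N) :
    Measurable (triProj m h : Tri (N - 1) → Tri m) := by
  unfold triProj
  fun_prop

lemma triProj_glue {N m : ℕ} (h : m < N) (y : Tri m) (u : UpTri m (N - 1)) :
    triProj m h (glue y u) = y := by
  funext k i
  exact congrFun (glue_of_lt y u k.2 (by omega)) i

lemma map_triProj_obp (θ : ℝ) {N : ℕ} (a : Fin N → ℝ) {n : ℕ} (hn : n < N - 1)
    (hn' : n + 1 < N) :
    Measure.map (triProj (n + 1) hn') (obp θ a) = volume.withDensity fun y =>
      lowWt θ n y * ((ENNReal.ofReal (∫ x in obpDomain a, obpWt θ a x))⁻¹ *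
        upDensity θ a n (y ⟨n, n.lt_succ_self⟩)) := by
  set c := (ENNReal.ofReal (∫ x in obpDomain a, obpWt θ a x))⁻¹ with hc
  have hW : Measurable fun x : Tri (N - 1) =>
      ENNReal.ofReal ((obpDomain a).indicator (obpWt θ a) x) := by
    simp only [ofReal_indicator_obpWt]
    refine Finset.measurable_fun_prod _ fun k _ => ?_
    have h : Measurable fun x : Tri (N - 1) => (x k, lvl a x (k.1 + 1) (by omega)) :=
      (measurable_pi_apply _).prodMk (measurable_lvl a _ _)
    exact (measurable_pairWt θ (k.1 + 1)).comp h
  have htop : Measurable fun y : Tri (n + 1) => y ⟨n, n.lt_succ_self⟩ := measurable_pi_apply _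
  have hup := measurable_upDensity θ a hn
  refine Measure.ext fun s hs => ?_
  have hpre := measurable_triProj (n + 1) hn' hs
  have hglue := measurePreserving_glue (m := n + 1) (M := N - 1) (by omega)
  have hlow : Measurable fun y =>
      s.indicator (lowWt θ n) y * upDensity θ a n (y ⟨n, n.lt_succ_self⟩) :=
    ((measurable_lowWt θ n).indicator hs).mul (hup.comp htop)
  have hint : ∀ y : Tri (n + 1), ∫⁻ u : UpTri (n + 1) (N - 1),
      (triProj (n + 1) hn' ⁻¹' s).indicator
        (fun x => ENNReal.ofReal ((obpDomain a).indicator (obpWt θ a) x)) (glue y u) =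
      s.indicator (lowWt θ n) y * upDensity θ a n (y ⟨n, n.lt_succ_self⟩) := by
    intro y
    rw [upDensity, ← lintegral_const_mul _ (measurable_upWt_glue θ a hn _)]
    refine lintegral_congr fun u => ?_
    by_cases hy : y ∈ s
    · rw [Set.indicator_of_mem (by rwa [Set.mem_preimage, triProj_glue]),
        Set.indicator_of_mem hy, ofReal_indicator_obpWt_glue θ a hn]
    · rw [Set.indicator_of_notMem (by rwa [Set.mem_preimage, triProj_glue]),
        Set.indicator_of_notMem hy, zero_mul]
  have hmeas : Measurable fun p : Tri (n + 1) × UpTri (n + 1) (N - 1) =>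
      (triProj (n + 1) hn' ⁻¹' s).indicator
        (fun x => ENNReal.ofReal ((obpDomain a).indicator (obpWt θ a) x)) (glue p.1 p.2) :=
    (hW.indicator hpre).comp hglue.measurable
  rw [Measure.map_apply (measurable_triProj _ _) hs, obp, ← hc, Measure.smul_apply,
    withDensity_apply _ hpre, withDensity_apply _ hs, ← lintegral_indicator hpre,
    ← hglue.lintegral_comp (hW.indicator hpre), Measure.volume_eq_prod,
    lintegral_prod _ hmeas.aemeasurable, smul_eq_mul]
  simp only [hint]
  rw [← lintegral_const_mul _ hlow, ← lintegral_indicator hs]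
  refine lintegral_congr fun y => ?_
  by_cases hy : y ∈ s
  · rw [Set.indicator_of_mem hy, Set.indicator_of_mem hy, mul_left_comm]
  · rw [Set.indicator_of_notMem hy, Set.indicator_of_notMem hy, zero_mul, mul_zero]

lemma map_top_withDensity {n : ℕ} {F : Tri (n + 1) → ℝ≥0∞} (hF : Measurable F)
    {G : (Fin (n + 1) → ℝ) → ℝ≥0∞} (hG : Measurable G) :
    Measure.map (fun y : Tri (n + 1) => y ⟨n, n.lt_succ_self⟩)
        (volume.withDensity fun y => F y * G (y ⟨n, n.lt_succ_self⟩)) =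
      volume.withDensity fun v => (∫⁻ x, F (snocTri x v)) * G v := by
  have htop : Measurable fun y : Tri (n + 1) => y ⟨n, n.lt_succ_self⟩ := measurable_pi_apply _
  have hFG : Measurable fun y => F y * G (y ⟨n, n.lt_succ_self⟩) := hF.mul (hG.comp htop)
  refine Measure.ext fun s hs => ?_
  have hpre := htop hs
  rw [Measure.map_apply htop hs, withDensity_apply _ hpre, withDensity_apply _ hs,
    ← lintegral_indicator hpre, ← lintegral_indicator hs,
    lintegral_tri_succ (hFG.indicator hpre)]
  refine lintegral_congr fun v => ?_
  have hpair : Measurable fun x : Tri n => (x, v) := by fun_prop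
  have hFv : Measurable fun x : Tri n => F (snocTri x v) :=
    hF.comp ((measurePreserving_snocTri n).measurable.comp hpair)
  by_cases hv : v ∈ s
  · rw [Set.indicator_of_mem hv, ← lintegral_mul_const _ hFv]
    refine lintegral_congr fun x => ?_
    rw [Set.indicator_of_mem (by rwa [Set.mem_preimage, snocTri_last]), snocTri_last]
  · rw [Set.indicator_of_notMem hv]
    refine (lintegral_congr fun x => ?_).trans lintegral_zero
    rw [Set.indicator_of_notMem (by rwa [Set.mem_preimage, snocTri_last])]

lemma measurable_lintegral_lowWt_snocTri (θ : ℝ) (n : ℕ) :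
    Measurable fun v : Fin (n + 1) → ℝ => ∫⁻ x, lowWt θ n (snocTri x v) := by
  have h : Measurable fun p : Tri n × (Fin (n + 1) → ℝ) => lowWt θ n (snocTri p.1 p.2) :=
    (measurable_lowWt θ n).comp (measurePreserving_snocTri n).measurable
  exact h.lintegral_prod_left'

lemma lowWt_eq_zero (θ : ℝ) {n : ℕ} {y : Tri (n + 1)} (hy : y ∉ triDomain (n + 1)) :
    lowWt θ n y = 0 := by
  have hy' : ¬ ∀ k : Fin (n + 1), ∀ hk : k.1 + 1 < n + 1,
    Interlaces (y k) (y ⟨k.1 + 1, hk⟩) := hy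
  push Not at hy'
  obtain ⟨k, hk, h⟩ := hy'
  exact Finset.prod_eq_zero (Finset.mem_univ (⟨k.1, by omega⟩ : Fin n)) (if_neg h)

lemma strictAnti_of_mem_triDomain {m : ℕ} {y : Tri m} (hy : y ∈ triDomain m) {k : ℕ}
    (hk : k < m) : StrictAnti (y ⟨k, hk⟩) := by
  cases k with
  | zero =>
    intro i j hij
    have hi := i.2
    have hj := j.2
    have hij' : i.1 < j.1 := hij
    simp only at hi hj
    omega
  | succ k =>
    have h : Interlaces (y ⟨k, by omega⟩) (y ⟨k + 1, hk⟩) := hy ⟨k, by omega⟩ hk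
    exact h.strictAnti_right

lemma prod_sub_rpow {k : ℕ} {u : Fin k → ℝ} (hu : StrictAnti u) (p : ℝ) :
    (∏ i, ∏ j, if i < j then (u i - u j) ^ p else 1) = vdm u ^ p := by
  rw [← prod_abs_sub_rpow]
  refine Finset.prod_congr rfl fun i _ => Finset.prod_congr rfl fun j _ => ?_
  split_ifs with h
  · rw [abs_of_pos (sub_pos.2 (hu h))]
  · rfl

lemma gibbsWt_eq {θ : ℝ} {n : ℕ} {y : Tri (n + 1)} (hy : y ∈ triDomain (n + 1)) :
    gibbsWt θ n y = (gibbsConst θ n)⁻¹ *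
      vdm (y ⟨n, n.lt_succ_self⟩) ^ (1 - 2 * θ) * ∏ k : Fin n,
      (vdm (y ⟨k.1, by omega⟩) ^ (2 - 2 * θ) *
        ∏ s, ∏ r, |y ⟨k.1 + 1, by omega⟩ s - y ⟨k.1, by omega⟩ r| ^ (θ - 1)) := by
  rw [gibbsWt, gibbsConst, inv_div,
    prod_sub_rpow (strictAnti_of_mem_triDomain hy n.lt_succ_self)]
  congr 1
  refine Finset.prod_congr rfl fun k _ => ?_
  rw [prod_sub_rpow (strictAnti_of_mem_triDomain hy _), Finset.prod_comm]
  congr 1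
  refine Finset.prod_congr rfl fun s _ => Finset.prod_congr rfl fun r _ => ?_
  rw [abs_sub_comm]

lemma gibbsWt_nonneg {θ : ℝ} (hθ : 0 < θ) {n : ℕ} {y : Tri (n + 1)}
    (hy : y ∈ triDomain (n + 1)) : 0 ≤ gibbsWt θ n y := by
  have hC := gibbsConst_pos hθ n
  rw [gibbsWt_eq hy]
  refine mul_nonneg (mul_nonneg (inv_nonneg.2 hC.le) (Real.rpow_nonneg (vdm_nonneg _) _))
    (Finset.prod_nonneg fun k _ => mul_nonneg (Real.rpow_nonneg (vdm_nonneg _) _) ?_)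
  positivity

/-- On the interlacing set, the Gibbs density is the normalized product of weights. -/
lemma ofReal_gibbsWt {θ : ℝ} (hθ : 0 < θ) {n : ℕ} {y : Tri (n + 1)}
    (hy : y ∈ triDomain (n + 1)) :
    ENNReal.ofReal (gibbsConst θ n * vdm (y ⟨n, n.lt_succ_self⟩) ^ (2 * θ - 1)) *
      ENNReal.ofReal (gibbsWt θ n y) = lowWt θ n y := by
  have hC := gibbsConst_pos hθ n
  have hv := vdm_pos (strictAnti_of_mem_triDomain hy n.lt_succ_self)
  have hlow : lowWt θ n y = ENNReal.ofReal (∏ k : Fin n,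
      (vdm (y ⟨k.1, by omega⟩) ^ (2 - 2 * θ) *
        ∏ s, ∏ r, |y ⟨k.1 + 1, by omega⟩ s - y ⟨k.1, by omega⟩ r| ^ (θ - 1))) := by
    rw [ENNReal.ofReal_prod_of_nonneg]
    · exact Finset.prod_congr rfl fun k _ => if_pos (hy ⟨k.1, by omega⟩ (by simp))
    · intro k _
      have := vdm_nonneg (y ⟨k.1, by omega⟩)
      positivity
  rw [hlow, gibbsWt_eq hy, ← ENNReal.ofReal_mul (by positivity)]
  congr 1
  have h1 : vdm (y ⟨n, n.lt_succ_self⟩) ^ (2 * θ - 1) *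
      vdm (y ⟨n, n.lt_succ_self⟩) ^ (1 - 2 * θ) = 1 := by
    rw [← Real.rpow_add hv]; norm_num
  rw [← mul_assoc, mul_mul_mul_comm, mul_inv_cancel₀ hC.ne', h1, one_mul, one_mul]

/-- (θ-Gibbs property of the orbital beta process, Lemma 2.4)
If `g` is the Lebesgue density of the `(n+1)`-st level of `𝕄^{a,θ}`, then the joint
distribution of the bottom `n+1` levels has Lebesgue density
`g(x⁽ⁿ⁺¹⁾) ·` (θ-Gibbs factor), supported on the interlacing set. -/
theorem orbital_beta_theta_gibbs
    (θ : ℝ) (hθ : 0 < θ) (N : ℕ) (hN : 3 ≤ N)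
    (a : Fin N → ℝ) (ha : StrictAnti a)
    (n : ℕ) (hn1 : 1 ≤ n) (hn2 : n ≤ N - 2)
    (g : (Fin (n + 1) → ℝ) → ℝ) (hg : Measurable g)
    (hdens : Measure.map (levelProj (n + 1) (by omega) (by omega)) (obp θ a) =
      volume.withDensity fun v => ENNReal.ofReal (g v)) :
    Measure.map (triProj (n + 1) (by omega)) (obp θ a) =
      volume.withDensity fun x =>
        ENNReal.ofReal
          ((triDomain (n + 1)).indicator
            (fun x => g (topLvl (by omega) x) * gibbsWt θ n x) x) := by
  have hn : n < N - 1 := by omega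
  have hn' : n + 1 < N := by omega
  have hlow := measurable_lowWt θ n
  have hup : Measurable fun v : Fin (n + 1) → ℝ =>
      (ENNReal.ofReal (∫ x in obpDomain a, obpWt θ a x))⁻¹ * upDensity θ a n v :=
    (measurable_upDensity θ a hn).const_mul _
  have htop : Measurable fun y : Tri (n + 1) => y ⟨n, n.lt_succ_self⟩ := measurable_pi_apply _
  have hmap := map_triProj_obp θ a hn hn'
  have hlevel : Measure.map (fun y : Tri (n + 1) => y ⟨n, n.lt_succ_self⟩)
      (Measure.map (triProj (n + 1) hn') (obp θ a)) =
      volume.withDensity fun v => ENNReal.ofReal (g v) := by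
    rw [Measure.map_map htop (measurable_triProj _ hn')]
    exact hdens
  rw [hmap, map_top_withDensity hlow hup] at hlevel
  replace hlevel := (withDensity_eq_iff_of_sigmaFinite
    ((measurable_lintegral_lowWt_snocTri θ n).mul hup).aemeasurable
    (ENNReal.measurable_ofReal.comp hg).aemeasurable).1 hlevel
  have hquasi : Measure.QuasiMeasurePreserving
      (fun y : Tri (n + 1) => y ⟨n, n.lt_succ_self⟩) volume volume :=
    Measure.quasiMeasurePreserving_eval (fun _ => volume) (⟨n, n.lt_succ_self⟩ : Fin (n + 1))
  have hae : ∀ᵐ y : Tri (n + 1), (∫⁻ x, lowWt θ n (snocTri x (y ⟨n, n.lt_succ_self⟩))) *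
      ((ENNReal.ofReal (∫ x in obpDomain a, obpWt θ a x))⁻¹ *
        upDensity θ a n (y ⟨n, n.lt_succ_self⟩)) =
      ENNReal.ofReal (g (y ⟨n, n.lt_succ_self⟩)) :=
    hquasi.ae_eq_comp hlevel
  rw [hmap]
  refine withDensity_congr_ae ?_
  filter_upwards [hae] with y hy
  by_cases hmem : y ∈ triDomain (n + 1)
  · rw [Set.indicator_of_mem hmem, ENNReal.ofReal_mul' (gibbsWt_nonneg hθ hmem),
      show topLvl (by omega) y = y ⟨n, n.lt_succ_self⟩ from rfl, ← hy,
      lintegral_lowWt_snocTri hθ n (strictAnti_of_mem_triDomain hmem n.lt_succ_self),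
      ← ofReal_gibbsWt hθ hmem]
    ring
  · rw [Set.indicator_of_notMem hmem, lowWt_eq_zero θ hmem, zero_mul, ENNReal.ofReal_zero]

end
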